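/- In the packing setup, assume h ≤ 1/(2(m+1)) and m^d·γ·h^{β+d} ≤ 1/2 (so that every f_θ is a probability density on [0,1]^d bounded below by 1/2). Then for every θ ∈ {0,1}^{m^d} and every index i ∈ {1,…,m^d}, the Kullback–Leibler divergence between the probability measures on [0,1]^d with densities f_{θ^{(i←1)}} and f_{θ^{(i←0)}} satisfies KL( f_{θ^{(i←1)}} ‖ f_{θ^{(i←0)}} ) ≤ 2·( 3·γ²·h^{2β+2d} + δ·h^{2β+d} ), where θ^{(i←j)} denotes θ with its i-th coordinate set to j. -/

import Mathlib

open MeasureTheory Real Finset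

noncomputable section

def cube (d : ℕ) : Set (Fin d → ℝ) := Set.Icc 0 1

/-- The grid point `p_η = ((η₁+1)/(m+1), …, (η_d+1)/(m+1))` for `η ∈ {0,…,m-1}^d`;
this enumerates the grid `{1/(m+1), …, m/(m+1)}^d`. -/
def gridPt (d m : ℕ) (η : Fin d → Fin m) : Fin d → ℝ := fun i => ((η i : ℝ) + 1) / (m + 1)

/-- The packing density
`f_θ(x) = 1 + h^β Σ_η θ_η ψ((x - p_η)/h) - ‖θ‖₁ γ h^{β+d}`, where `γ = ∫ ψ`. -/
def packDensity (d m : ℕ) (β h : ℝ) (ψ : (Fin d → ℝ) → ℝ)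
    (θ : (Fin d → Fin m) → Bool) (x : Fin d → ℝ) : ℝ :=
  1 + h ^ β * ∑ η : Fin d → Fin m,
      (if θ η then (1 : ℝ) else 0) * ψ (fun i => (x i - gridPt d m η i) / h)
    - (∑ η : Fin d → Fin m, if θ η then (1 : ℝ) else 0) * (∫ y : Fin d → ℝ, ψ y) *
        h ^ (β + d)

/-- Hamming distance between two parameters `θ₁, θ₂ ∈ {0,1}^{m^d}`. -/
def hamB (d m : ℕ) (θ₁ θ₂ : (Fin d → Fin m) → Bool) : ℕ :=
  (Finset.univ.filter fun η => θ₁ η ≠ θ₂ η).card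

lemma sum_update_true_eq {ι : Type*} [Fintype ι] [DecidableEq ι] (θ : ι → Bool) (i : ι)
    (v : ι → ℝ) :
    ∑ j, (if Function.update θ i true j then (1 : ℝ) else 0) * v j =
      ∑ j, (if Function.update θ i false j then (1 : ℝ) else 0) * v j + v i := by
  rw [← sub_eq_iff_eq_add', ← Finset.sum_sub_distrib, Finset.sum_eq_single i]
  · simp
  · intro j _ hj
    simp [Function.update_of_ne hj]
  · simp

lemma packDensity_update_true (d m : ℕ) (β h : ℝ) (ψ : (Fin d → ℝ) → ℝ)
    (θ : (Fin d → Fin m) → Bool) (η₀ : Fin d → Fin m) (x : Fin d → ℝ) :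
    packDensity d m β h ψ (Function.update θ η₀ true) x =
      packDensity d m β h ψ (Function.update θ η₀ false) x +
        (h ^ β * ψ (fun i => (x i - gridPt d m η₀ i) / h) -
          (∫ y : Fin d → ℝ, ψ y) * h ^ (β + d)) := by
  have h1 := sum_update_true_eq θ η₀ fun η => ψ (fun i => (x i - gridPt d m η i) / h)
  have h2 := sum_update_true_eq θ η₀ fun _ => (1 : ℝ)
  simp only [mul_one] at h2
  unfold packDensity
  rw [h1, h2]
  ring

lemma half_le_packDensity (d m : ℕ) (β h : ℝ) (ψ : (Fin d → ℝ) → ℝ) (hψ0 : ∀ x, 0 ≤ ψ x)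
    (hh0 : 0 < h)
    (hsmall : (m : ℝ) ^ d * (∫ y : Fin d → ℝ, ψ y) * h ^ (β + d) ≤ 1 / 2)
    (θ : (Fin d → Fin m) → Bool) (x : Fin d → ℝ) :
    1 / 2 ≤ packDensity d m β h ψ θ x := by
  have hsum : (∑ η : Fin d → Fin m, if θ η then (1 : ℝ) else 0) ≤ (m : ℝ) ^ d := by
    calc (∑ η : Fin d → Fin m, if θ η then (1 : ℝ) else 0)
        ≤ ∑ _η : Fin d → Fin m, (1 : ℝ) :=
          Finset.sum_le_sum fun η _ => by split_ifs <;> norm_num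
      _ = (m : ℝ) ^ d := by simp
  have hγ : 0 ≤ ∫ y : Fin d → ℝ, ψ y := integral_nonneg hψ0
  have hbump : 0 ≤ h ^ β * ∑ η : Fin d → Fin m,
      (if θ η then (1 : ℝ) else 0) * ψ (fun i => (x i - gridPt d m η i) / h) := by
    refine mul_nonneg (by positivity) (Finset.sum_nonneg fun η _ => mul_nonneg ?_ (hψ0 _))
    split_ifs <;> norm_num
  have hmass : (∑ η : Fin d → Fin m, if θ η then (1 : ℝ) else 0) * (∫ y : Fin d → ℝ, ψ y) *
      h ^ (β + d) ≤ (m : ℝ) ^ d * (∫ y : Fin d → ℝ, ψ y) * h ^ (β + d) := by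
    gcongr
  unfold packDensity
  linarith

lemma continuous_packDensity (d m : ℕ) (β h : ℝ) (ψ : (Fin d → ℝ) → ℝ) (hψc : Continuous ψ)
    (θ : (Fin d → Fin m) → Bool) : Continuous (packDensity d m β h ψ θ) := by
  unfold packDensity
  fun_prop

lemma hasCompactSupport_of_one_le_sum_sq {d : ℕ} {ψ : (Fin d → ℝ) → ℝ}
    (hψsupp : ∀ x : Fin d → ℝ, 1 ≤ ∑ i, x i ^ 2 → ψ x = 0) : HasCompactSupport ψ := by
  refine HasCompactSupport.intro (isCompact_closedBall (0 : Fin d → ℝ) 1) fun x hx => hψsupp x ?_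
  rw [mem_closedBall_zero_iff, pi_norm_le_iff_of_nonneg zero_le_one] at hx
  push Not at hx
  obtain ⟨i, hi⟩ := hx
  rw [Real.norm_eq_abs] at hi
  calc (1 : ℝ) ≤ x i ^ 2 := (one_le_sq_iff_one_le_abs _).2 hi.le
    _ ≤ ∑ i, x i ^ 2 := Finset.single_le_sum (fun j _ => sq_nonneg (x j)) (Finset.mem_univ i)

/-- The integral over any set of a rescaled and translated nonnegative function is at most
its integral over the whole space. -/
lemma setIntegral_rescale_le {d : ℕ} {g : (Fin d → ℝ) → ℝ} (hg0 : ∀ x, 0 ≤ g x)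
    (hgi : Integrable g) {h : ℝ} (hh0 : 0 < h) (p : Fin d → ℝ) (s : Set (Fin d → ℝ)) :
    ∫ x in s, g (fun i => (x i - p i) / h) ≤ h ^ d * ∫ y, g y := by
  have heq : (fun x : Fin d → ℝ => g (fun i => (x i - p i) / h)) =
      fun x => g (h⁻¹ • (x - p)) := by
    funext x
    congr 1
    funext i
    simp [div_eq_inv_mul]
  have hint : Integrable fun x : Fin d → ℝ => g (h⁻¹ • (x - p)) :=
    (hgi.comp_smul (inv_ne_zero hh0.ne')).comp_sub_right p
  rw [heq]
  calc ∫ x in s, g (h⁻¹ • (x - p)) ≤ ∫ x, g (h⁻¹ • (x - p)) :=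
        setIntegral_le_integral hint (Filter.Eventually.of_forall fun x => hg0 _)
    _ = ∫ x, g (h⁻¹ • x) := integral_sub_right_eq_self (fun x => g (h⁻¹ • x)) p
    _ = h ^ d * ∫ y, g y := by
        rw [Measure.integral_comp_inv_smul]
        simp [abs_of_pos hh0]

/-- Comparison of the Kullback-Leibler integrand with the chi-square integrand. -/
lemma log_div_mul_le {q a c : ℝ} (hq : 1 / 2 ≤ q) (hp : 0 < q + (a - c)) (ha : 0 ≤ a)
    (hc : 0 ≤ c) :
    Real.log ((q + (a - c)) / q) * (q + (a - c)) ≤ (a - c) + 2 * (a ^ 2 + c ^ 2) := by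
  have hq0 : 0 < q := by linarith
  have hlog : Real.log ((q + (a - c)) / q) ≤ (a - c) / q :=
    (Real.log_le_sub_one_of_pos (div_pos hp hq0)).trans_eq (by field_simp; ring)
  have hsq : (a - c) ^ 2 / q ≤ 2 * (a - c) ^ 2 := by
    rw [div_le_iff₀ hq0]
    nlinarith [sq_nonneg (a - c)]
  calc Real.log ((q + (a - c)) / q) * (q + (a - c))
      ≤ (a - c) / q * (q + (a - c)) := by gcongr
    _ = (a - c) + (a - c) ^ 2 / q := by field_simp
    _ ≤ (a - c) + 2 * (a ^ 2 + c ^ 2) := by nlinarith [mul_nonneg ha hc]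

/-- KL control within the packing family. In the packing setup, if
`h ≤ 1/(2(m+1))` and `m^d γ h^{β+d} ≤ 1/2` (so that every `f_θ` is a probability
density bounded below by `1/2`), then for every `θ` and every index `η₀`, the
Kullback–Leibler divergence `KL(f_{θ^{(η₀←1)}} ‖ f_{θ^{(η₀←0)}})
= ∫ log(f_{θ^{(η₀←1)}}/f_{θ^{(η₀←0)}}) f_{θ^{(η₀←1)}}` satisfies
`KL ≤ 2 (3 γ² h^{2β+2d} + δ h^{2β+d})`, where `γ = ∫ψ`, `δ = ∫ψ²`. -/
theorem stmt19 (d m : ℕ) (hd : 1 ≤ d) (hm : 1 ≤ m) (β : ℝ) (hβ : 0 < β)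
    (ψ : (Fin d → ℝ) → ℝ) (hψc : Continuous ψ) (hψ0 : ∀ x, 0 ≤ ψ x)
    (hψne : ∃ x, ψ x ≠ 0)
    (hψsupp : ∀ x : Fin d → ℝ, 1 ≤ ∑ i, x i ^ 2 → ψ x = 0)
    (h : ℝ) (hh0 : 0 < h) (hh1 : h ≤ 1 / (2 * ((m : ℝ) + 1)))
    (hsmall : (m : ℝ) ^ d * (∫ y : Fin d → ℝ, ψ y) * h ^ (β + d) ≤ 1 / 2)
    (θ : (Fin d → Fin m) → Bool) (η₀ : Fin d → Fin m) :
    (∫ x in cube d,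
        Real.log (packDensity d m β h ψ (Function.update θ η₀ true) x /
            packDensity d m β h ψ (Function.update θ η₀ false) x) *
          packDensity d m β h ψ (Function.update θ η₀ true) x)
      ≤ 2 * (3 * (∫ y : Fin d → ℝ, ψ y) ^ 2 * h ^ (2 * β + 2 * (d : ℝ))
          + (∫ y : Fin d → ℝ, ψ y ^ 2) * h ^ (2 * β + d)) := by
  set γ := ∫ y : Fin d → ℝ, ψ y
  set δ := ∫ y : Fin d → ℝ, ψ y ^ 2
  set p := packDensity d m β h ψ (Function.update θ η₀ true)
  set q := packDensity d m β h ψ (Function.update θ η₀ false)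
  set c := γ * h ^ (β + d) with hcdef
  let b : (Fin d → ℝ) → ℝ := fun x => ψ (fun i => (x i - gridPt d m η₀ i) / h)
  have hpq : ∀ x, p x = q x + (h ^ β * b x - c) := packDensity_update_true d m β h ψ θ η₀
  have hp : ∀ x, 1 / 2 ≤ p x := half_le_packDensity d m β h ψ hψ0 hh0 hsmall _
  have hq : ∀ x, 1 / 2 ≤ q x := half_le_packDensity d m β h ψ hψ0 hh0 hsmall _
  have hpc : Continuous p := continuous_packDensity d m β h ψ hψc _
  have hqc : Continuous q := continuous_packDensity d m β h ψ hψc _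
  have hbc : Continuous b := by fun_prop
  have hγ0 : 0 ≤ γ := integral_nonneg hψ0
  have hc0 : 0 ≤ c := by positivity
  have hψK : HasCompactSupport ψ := hasCompactSupport_of_one_le_sum_sq hψsupp
  have hψ2K : HasCompactSupport fun x => ψ x ^ 2 :=
    hasCompactSupport_of_one_le_sum_sq fun x hx => by simp [hψsupp x hx]
  have hint : ∀ f : (Fin d → ℝ) → ℝ, Continuous f → IntegrableOn f (cube d) := fun f hf =>
    hf.continuousOn.integrableOn_compact isCompact_Icc
  have hb1 : ∫ x in cube d, b x ≤ h ^ d * γ :=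
    setIntegral_rescale_le hψ0 (hψc.integrable_of_hasCompactSupport hψK) hh0 _ _
  have hb2 : ∫ x in cube d, b x ^ 2 ≤ h ^ d * δ :=
    setIntegral_rescale_le (g := fun x => ψ x ^ 2) (fun x => sq_nonneg _)
      ((hψc.pow 2).integrable_of_hasCompactSupport hψ2K) hh0 _ _
  have hvol : volume.real (cube d) = 1 := by
    simp [cube, measureReal_def, Real.volume_Icc_pi]
  have hbd : h ^ (β + d) = h ^ β * h ^ d := by
    rw [Real.rpow_add hh0, Real.rpow_natCast]
  have h2β : h ^ (2 * β) = (h ^ β) ^ 2 := by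
    rw [mul_comm, Real.rpow_mul hh0.le]
    norm_cast
  have h2d : h ^ (2 * (d : ℝ)) = (h ^ d) ^ 2 := by
    rw [mul_comm, Real.rpow_mul hh0.le, Real.rpow_natCast]
    norm_cast
  have hlogc : Continuous fun x => Real.log (p x / q x) * p x :=
    ((hpc.div hqc fun x => by linarith [hq x]).log fun x =>
      (div_pos (by linarith [hp x]) (by linarith [hq x])).ne').mul hpc
  calc ∫ x in cube d, Real.log (p x / q x) * p x
      ≤ ∫ x in cube d, (h ^ β * b x + 2 * (h ^ β) ^ 2 * b x ^ 2 + (2 * c ^ 2 - c)) := by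
        refine setIntegral_mono (hint _ hlogc) (hint _ (by fun_prop)) fun x => ?_
        have ha : 0 ≤ h ^ β * b x := mul_nonneg (by positivity) (hψ0 _)
        have hx := log_div_mul_le (hq x) (by linarith [hp x, hpq x]) ha hc0
        rw [← hpq x] at hx
        linarith
    _ = h ^ β * (∫ x in cube d, b x) + 2 * (h ^ β) ^ 2 * (∫ x in cube d, b x ^ 2) +
          (2 * c ^ 2 - c) := by
        rw [integral_add (hint _ (by fun_prop)) (hint _ (by fun_prop)),
          integral_add (hint _ (by fun_prop)) (hint _ (by fun_prop)),
          integral_const_mul, integral_const_mul, setIntegral_const, hvol, one_smul]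
    _ ≤ h ^ β * (h ^ d * γ) + 2 * (h ^ β) ^ 2 * (h ^ d * δ) + (2 * c ^ 2 - c) := by
        gcongr
    _ = 2 * (γ ^ 2 * h ^ (2 * β + 2 * (d : ℝ)) + δ * h ^ (2 * β + d)) := by
        rw [hcdef, hbd, Real.rpow_add hh0, Real.rpow_add hh0, h2β, h2d, Real.rpow_natCast]
        ring
    _ ≤ 2 * (3 * γ ^ 2 * h ^ (2 * β + 2 * (d : ℝ)) + δ * h ^ (2 * β + d)) := by
        have : 0 ≤ γ ^ 2 * h ^ (2 * β + 2 * (d : ℝ)) := by positivity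
        linarith

end
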